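/- arXiv:1210.6330 — 2 statements merged into one kernel-verified Lean document; each statement's English description precedes it below -/
import Mathlib

section
/- Let c : ℝ^m → ℝ^m be a C¹ vector field with bounded divergence such that the Poisson bracket [b,c] := (b·∇_y)c − (∂_yb)c vanishes identically. Suppose u ∈ L²(ℝ^m) is such that there exists w ∈ L²(ℝ^m) with ∫_{ℝ^m} u (c·∇_y φ) dy = −∫_{ℝ^m} w φ dy for every φ ∈ C¹_c(ℝ^m) (i.e. div_y(uc) = w in the sense of distributions). Then ∫_{ℝ^m} ⟨u⟩ (c·∇_y φ) dy = −∫_{ℝ^m} ⟨w⟩ φ dy for every φ ∈ C¹_c(ℝ^m); that is, div_y(⟨u⟩ c) = ⟨div_y(uc)⟩ in the sense of distributions. -/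
open MeasureTheory Filter Topology

set_option linter.unusedSectionVars false

section ode
variable {E : Type*} [NormedAddCommGroup E] [NormedSpace ℝ E] [FiniteDimensional ℝ E]

lemma aux_lip {F : Type*} [NormedAddCommGroup F] [NormedSpace ℝ F] {b : E → F} (hb : ContDiff ℝ 1 b) (R : ℝ) :
    ∃ L : NNReal, LipschitzOnWith L b (Metric.closedBall 0 R) :=
  (hb.locallyLipschitz).locallyLipschitzOn.exists_lipschitzOnWith_of_compact
      (isCompact_closedBall 0 R)

lemma aux_bound {b : E → E} {C : ℝ} (hgrow : ∀ y, ‖b y‖ ≤ C * (1 + ‖y‖)) (hC : 0 < C)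
    {Y : ℝ → E → E} (hY0 : ∀ y, Y 0 y = y)
    (hYd : ∀ s y, HasDerivAt (fun t => Y t y) (b (Y s y)) s) (R T : ℝ) :
    ∃ R', 0 ≤ R' ∧ ∀ y, ‖y‖ ≤ R → ∀ t ∈ Set.Icc 0 T, ‖Y t y‖ ≤ R' := by
  refine ⟨max 0 (gronwallBound (max R 0) C C T), le_max_left _ _, fun y hy t ht => ?_⟩
  have h := norm_le_gronwallBound_of_norm_deriv_right_le (f := fun t => Y t y)
    (f' := fun t => b (Y t y)) (δ := max R 0) (K := C) (ε := C) (a := 0) (b := T)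
    (fun s _ => (hYd s y).continuousAt.continuousWithinAt)
    (fun s _ => (hYd s y).hasDerivWithinAt) (by simp only [hY0]; exact hy.trans (le_max_left _ _))
    (fun s _ => (hgrow _).trans (le_of_eq (by ring))) t ht
  refine h.trans (le_trans ?_ (le_max_right _ _))
  exact gronwallBound_mono (le_max_right _ _) hC.le hC.le (by simpa using ht.2)

lemma aux_unif {b : E → E} (hb : ContDiff ℝ 1 b) (R ε : ℝ) (hε : 0 < ε) :
    ∃ δ > 0, ∀ x, ‖x‖ ≤ R → ∀ v, ‖v‖ ≤ δ →
      ‖b (x + v) - b x - fderiv ℝ b x v‖ ≤ ε * ‖v‖ := by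
  have hc : Continuous (fderiv ℝ b) := hb.continuous_fderiv (by norm_num)
  have huc := (isCompact_closedBall (0:E) (R+1)).uniformContinuousOn_of_continuous hc.continuousOn
  rw [Metric.uniformContinuousOn_iff] at huc
  obtain ⟨δ, hδ, h⟩ := huc ε hε
  refine ⟨min 1 (δ/2), by positivity, fun x hx v hv => ?_⟩
  have hv1 : ‖v‖ ≤ 1 := hv.trans (min_le_left _ _)
  have hv2 : ‖v‖ ≤ δ/2 := hv.trans (min_le_right _ _)
  have := (convex_segment x (x+v)).norm_image_sub_le_of_norm_fderiv_le' (𝕜 := ℝ) (f := b)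
    (φ := fderiv ℝ b x) (C := ε) (x := x) (y := x + v)
    (fun z _ => (hb.differentiable (by norm_num)) z) ?_ (left_mem_segment _ _ _)
    (right_mem_segment _ _ _)
  · simpa using this
  · intro z hz
    have hzx : ‖z - x‖ ≤ ‖v‖ := by
      have := norm_sub_le_of_mem_segment hz
      simpa using this
    have hzn : ‖z‖ ≤ R + 1 := by
      have := norm_add_le x (z - x); simp at this; linarith
    have := h z (by simpa using hzn) x (by simp; linarith) (by rw [dist_eq_norm]; linarith)
    rw [dist_eq_norm] at this
    exact this.le

lemma aux_lipflow {b : E → E} (hb : ContDiff ℝ 1 b) {C : ℝ}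
    (hgrow : ∀ y, ‖b y‖ ≤ C * (1 + ‖y‖)) (hC : 0 < C)
    {Y : ℝ → E → E} (hY0 : ∀ y, Y 0 y = y)
    (hYd : ∀ s y, HasDerivAt (fun t => Y t y) (b (Y s y)) s) (R t : ℝ) (ht : 0 ≤ t) :
    ∃ L : NNReal, LipschitzOnWith L (Y t) (Metric.closedBall 0 R) := by
  obtain ⟨R', -, hR'⟩ := aux_bound hgrow hC hY0 hYd R t
  obtain ⟨L, hL⟩ := aux_lip hb R'
  refine ⟨(Real.exp (L * t)).toNNReal, LipschitzOnWith.of_dist_le_mul fun x hx y hy => ?_⟩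
  have := dist_le_of_trajectories_ODE_of_mem (v := fun _ => b) (s := fun _ => Metric.closedBall 0 R')
    (K := L) (f := fun t => Y t x) (g := fun t => Y t y) (a := 0) (b := t) (δ := dist x y)
    (fun _ _ => hL) (fun s _ => (hYd s x).continuousAt.continuousWithinAt)
    (fun s _ => (hYd s x).hasDerivWithinAt)
    (fun s hs => by simpa using hR' x (by simpa using hx) s ⟨hs.1, hs.2.le⟩)
    (fun s _ => (hYd s y).continuousAt.continuousWithinAt)
    (fun s _ => (hYd s y).hasDerivWithinAt)
    (fun s hs => by simpa using hR' y (by simpa using hy) s ⟨hs.1, hs.2.le⟩)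
    (by simp [hY0]) t ⟨ht, le_rfl⟩
  rw [Real.coe_toNNReal _ (Real.exp_pos _).le, mul_comm]
  simpa using this

lemma aux_unique {b : E → E} (hb : ContDiff ℝ 1 b) {f g : ℝ → E}
    (hf : ∀ s, HasDerivAt f (b (f s)) s) (hg : ∀ s, HasDerivAt g (b (g s)) s)
    (h0 : f 0 = g 0) (t : ℝ) (ht : 0 ≤ t) : f t = g t := by
  have hfc : Continuous f := continuous_iff_continuousAt.2 fun s => (hf s).continuousAt
  have hgc : Continuous g := continuous_iff_continuousAt.2 fun s => (hg s).continuousAt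
  obtain ⟨R1, h1⟩ := (isCompact_Icc (a := 0) (b := t)).exists_bound_of_continuousOn hfc.continuousOn
  obtain ⟨R2, h2⟩ := (isCompact_Icc (a := 0) (b := t)).exists_bound_of_continuousOn hgc.continuousOn
  obtain ⟨L, hL⟩ := aux_lip hb (max R1 R2)
  have := dist_le_of_trajectories_ODE_of_mem (v := fun _ => b)
    (s := fun _ => Metric.closedBall 0 (max R1 R2))
    (K := L) (f := f) (g := g) (a := 0) (b := t) (δ := 0)
    (fun _ _ => hL) hfc.continuousOn (fun s _ => (hf s).hasDerivWithinAt)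
    (fun s hs => by simpa using Or.inl (h1 s ⟨hs.1, hs.2.le⟩))
    hgc.continuousOn (fun s _ => (hg s).hasDerivWithinAt)
    (fun s hs => by simpa using Or.inr (h2 s ⟨hs.1, hs.2.le⟩))
    (by simp [h0]) t ⟨ht, le_rfl⟩
  simpa using this

lemma aux_rev {b : E → E} {Y : ℝ → E → E}
    (hYd : ∀ s y, HasDerivAt (fun t => Y t y) (b (Y s y)) s) (s : ℝ) (y : E) :
    HasDerivAt (fun t => Y (-t) y) (-b (Y (-s) y)) s := by
  have := (hYd (-s) y).scomp s (hasDerivAt_neg s)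
  simpa [Function.comp_def] using this

lemma aux_group {b : E → E} (hb : ContDiff ℝ 1 b)
    {Y : ℝ → E → E} (hY0 : ∀ y, Y 0 y = y)
    (hYd : ∀ s y, HasDerivAt (fun t => Y t y) (b (Y s y)) s) (s t : ℝ) (y : E) :
    Y t (Y s y) = Y (t + s) y := by
  have key : ∀ r, HasDerivAt (fun t => Y (t + s) y) (b (Y (r + s) y)) r := fun r =>
    (hYd (r+s) y).comp_add_const r s
  rcases le_total 0 t with ht | ht
  · exact aux_unique hb (f := fun t => Y t (Y s y)) (g := fun t => Y (t+s) y)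
      (fun r => hYd r _) key (by simp [hY0]) t ht
  · have := aux_unique (b := fun z => - b z) hb.neg (f := fun t => Y (-t) (Y s y))
      (g := fun t => Y (-t+s) y)
      (fun r => aux_rev hYd r _) (fun r => by
        have := (key (-r)).scomp r (hasDerivAt_neg r)
        simpa [Function.comp_def] using this) (by simp [hY0]) (-t) (by linarith)
    simpa using this

lemma aux_star {b c : E → E} (hb : ContDiff ℝ 1 b) (hcc : ContDiff ℝ 1 c) {C : ℝ}
    (hgrow : ∀ y, ‖b y‖ ≤ C * (1 + ‖y‖)) (hC : 0 < C)
    {Y : ℝ → E → E} (hY0 : ∀ y, Y 0 y = y)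
    (hYd : ∀ s y, HasDerivAt (fun t => Y t y) (b (Y s y)) s)
    (hbc : ∀ y, fderiv ℝ c y (b y) - fderiv ℝ b y (c y) = 0) (t : ℝ) (ht : 0 ≤ t) (y : E) :
    (fun p : E × ℝ => Y t (p.1 + p.2 • c y) - Y t p.1 - p.2 • c (Y t y)) =o[𝓝 (y, 0)]
      (fun p => p.2) := by
  obtain ⟨L', hL'⟩ := aux_lipflow hb hgrow hC hY0 hYd (‖y‖ + 1) t ht
  have hYc : ContinuousAt (Y t) y :=
    hL'.continuousOn.continuousAt (Metric.closedBall_mem_nhds_of_mem (by simp))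
  obtain ⟨R1, hR10, hR1⟩ := aux_bound hgrow hC hY0 hYd (‖y‖ + 1 + ‖c y‖) t
  obtain ⟨M, hM⟩ := (isCompact_closedBall (0:E) R1).exists_bound_of_continuousOn
    hcc.continuous.continuousOn
  obtain ⟨L, hL⟩ := aux_lip hb (R1 + |M|)
  set A := gronwallBound 1 L (|M|) t with hA
  have hA0 : 0 ≤ A := by
    have := gronwallBound_mono (δ := 1) (K := L) (ε := |M|) (by norm_num) (abs_nonneg _)
      L.2 ht
    simp only [gronwallBound_x0] at this
    linarith
  have hlin : ∀ κ : ℝ, gronwallBound κ L (κ * |M|) t = κ * A := by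
    intro κ
    simp only [hA, gronwallBound]
    split_ifs <;> ring
  rw [Asymptotics.isLittleO_iff]
  intro ε hε
  -- choose η with η * A + η ≤ ε
  obtain ⟨η, hη, hηA⟩ : ∃ η > 0, η * A + η ≤ ε :=
    ⟨ε / (A + 1), by positivity, le_of_eq (by field_simp)⟩
  obtain ⟨δ, hδ, hU⟩ := aux_unif hb R1 η hη
  have e1 : ∀ᶠ p : E × ℝ in 𝓝 (y, 0), ‖p.1 - y‖ < 1 := by
    have : ContinuousAt (fun p : E × ℝ => ‖p.1 - y‖) (y, 0) := by fun_prop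
    exact this.eventually_lt continuousAt_const (by simp)
  have e2 : ∀ᶠ p : E × ℝ in 𝓝 (y, 0), |p.2| < 1 := by
    have : ContinuousAt (fun p : E × ℝ => |p.2|) (y, 0) := by fun_prop
    exact this.eventually_lt continuousAt_const (by simp)
  have e3 : ∀ᶠ p : E × ℝ in 𝓝 (y, 0), |p.2| * |M| < δ := by
    have : ContinuousAt (fun p : E × ℝ => |p.2| * |M|) (y, 0) := by fun_prop
    exact this.eventually_lt continuousAt_const (by simpa)
  have e4 : ∀ᶠ p : E × ℝ in 𝓝 (y, 0), ‖c p.1 - c y‖ < η := by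
    have hc := hcc.continuous
    have : ContinuousAt (fun p : E × ℝ => ‖c p.1 - c y‖) (y, 0) := by fun_prop
    exact this.eventually_lt continuousAt_const (by simpa)
  have e5 : ∀ᶠ p : E × ℝ in 𝓝 (y, 0), ‖c (Y t p.1) - c (Y t y)‖ < η := by
    have h1 : ContinuousAt (fun p : E × ℝ => Y t p.1) (y, 0) :=
      ContinuousAt.comp (g := Y t) (f := Prod.fst) hYc continuousAt_fst
    have h2 : ContinuousAt (fun p : E × ℝ => c (Y t p.1)) (y, 0) :=
      hcc.continuous.continuousAt.comp h1
    have : ContinuousAt (fun p : E × ℝ => ‖c (Y t p.1) - c (Y t y)‖) (y, 0) :=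
      (h2.sub continuousAt_const).norm
    exact this.eventually_lt continuousAt_const (by simpa)
  filter_upwards [e1, e2, e3, e4, e5] with ⟨x, h⟩ h1 h2 h3 h4 h5
  simp only at h1 h2 h3 h4 h5 ⊢
  have hx : ‖x‖ ≤ ‖y‖ + 1 := by
    have := norm_add_le y (x - y); simp at this; linarith
  have hxx : ‖x‖ ≤ ‖y‖ + 1 + ‖c y‖ := by have := norm_nonneg (c y); linarith
  have hxh : ‖x + h • c y‖ ≤ ‖y‖ + 1 + ‖c y‖ := by
    refine (norm_add_le _ _).trans ?_
    rw [norm_smul, Real.norm_eq_abs]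
    have : |h| * ‖c y‖ ≤ 1 * ‖c y‖ := by gcongr
    linarith
  have hcM : ∀ s ∈ Set.Icc 0 t, ‖c (Y s x)‖ ≤ |M| := fun s hs =>
    (hM _ (by simpa using hR1 x hxx s hs)).trans (le_abs_self _)
  have hhc : ∀ s ∈ Set.Icc 0 t, ‖h • c (Y s x)‖ ≤ |h| * |M| := fun s hs => by
    rw [norm_smul, Real.norm_eq_abs]; gcongr; exact hcM s hs
  have hfd : ∀ s, HasDerivAt (fun s => Y s x + h • c (Y s x))
      (b (Y s x) + h • fderiv ℝ b (Y s x) (c (Y s x))) s := fun s => by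
    have hcd := ((hcc.differentiable (by norm_num)) (Y s x)).hasFDerivAt.comp_hasDerivAt s (hYd s x)
    rw [sub_eq_zero.1 (hbc (Y s x))] at hcd
    exact (hYd s x).add (hcd.const_smul h)
  have main := dist_le_of_approx_trajectories_ODE_of_mem (v := fun _ => b)
    (s := fun _ => Metric.closedBall 0 (R1 + |M|))
    (K := L) (f := fun s => Y s x + h • c (Y s x)) (g := fun s => Y s (x + h • c y))
    (f' := fun s => b (Y s x) + h • fderiv ℝ b (Y s x) (c (Y s x)))
    (g' := fun s => b (Y s (x + h • c y)))
    (a := 0) (b := t) (δ := |h| * η) (εf := |h| * η * |M|) (εg := 0)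
    (fun _ _ => hL) (fun s _ => (hfd s).continuousAt.continuousWithinAt)
    (fun s _ => (hfd s).hasDerivWithinAt)
    (fun s hs => by
      have hs' : s ∈ Set.Icc 0 t := ⟨hs.1, hs.2.le⟩
      have := hU (Y s x) (hR1 x hxx s hs') (h • c (Y s x)) ((hhc s hs').trans h3.le)
      rw [dist_comm, dist_eq_norm]
      rw [map_smul] at this
      calc _ = ‖b (Y s x + h • c (Y s x)) - b (Y s x) - h • fderiv ℝ b (Y s x) (c (Y s x))‖ := by
            congr 1; abel
        _ ≤ _ := this
        _ ≤ η * (|h| * |M|) := by gcongr; exact hhc s hs'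
        _ = _ := by ring)
    (fun s hs => by
      have hs' : s ∈ Set.Icc 0 t := ⟨hs.1, hs.2.le⟩
      have := hhc s hs'
      have h6 := hR1 x hxx s hs'
      have : |h| * |M| ≤ 1 * |M| := by gcongr
      have := norm_add_le (Y s x) (h • c (Y s x))
      simp only [Metric.mem_closedBall, dist_zero_right]; linarith)
    (fun s _ => (hYd s _).continuousAt.continuousWithinAt)
    (fun s _ => (hYd s _).hasDerivWithinAt)
    (fun s hs => by simp)
    (fun s hs => by
      have hs' : s ∈ Set.Icc 0 t := ⟨hs.1, hs.2.le⟩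
      have h6 := hR1 _ hxh s hs'
      have := abs_nonneg M
      simp only [Metric.mem_closedBall, dist_zero_right]; linarith)
    (by
      simp only [hY0]
      rw [dist_add_left, dist_eq_norm, ← smul_sub, norm_smul, Real.norm_eq_abs]
      gcongr) t ⟨ht, le_rfl⟩
  rw [add_zero, sub_zero, hlin, dist_comm, dist_eq_norm] at main
  rw [Real.norm_eq_abs]
  calc ‖Y t (x + h • c y) - Y t x - h • c (Y t y)‖
      = ‖(Y t (x + h • c y) - (Y t x + h • c (Y t x))) + h • (c (Y t x) - c (Y t y))‖ := by
        congr 1; rw [smul_sub]; abel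
    _ ≤ |h| * η * A + |h| * η := by
        refine (norm_add_le _ _).trans (add_le_add main ?_)
        rw [norm_smul, Real.norm_eq_abs]; gcongr
    _ = |h| * (η * A + η) := by ring
    _ ≤ |h| * ε := by gcongr
    _ = _ := by ring

end ode

section moll
variable {E : Type*} [NormedAddCommGroup E] [NormedSpace ℝ E] [FiniteDimensional ℝ E]

lemma aux_hilbert {F : Type*} [NormedAddCommGroup F] [InnerProductSpace ℝ F] [CompleteSpace F]
    (U : ℝ → F →L[ℝ] F) (hU : ∀ s x, ‖U s x‖ ≤ ‖x‖)
    (hadd : ∀ s t x, U s (U t x) = U (s + t) x) (x : F) :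
    ∃ x0 ∈ closure (convexHull ℝ (Set.range fun s => U s x)), ∀ s, U s x0 = x0 := by
  set S := closure (convexHull ℝ (Set.range fun s => U s x)) with hS
  have hconv : Convex ℝ S := (convex_convexHull ℝ _).closure
  have hne : S.Nonempty := ⟨U 0 x, subset_closure (subset_convexHull ℝ _ ⟨0, rfl⟩)⟩
  obtain ⟨x0, hx0, hmin⟩ := exists_norm_eq_iInf_of_complete_convex hne
    isClosed_closure.isComplete hconv 0
  rw [norm_eq_iInf_iff_real_inner_le_zero hconv hx0] at hmin
  refine ⟨x0, hx0, fun s => ?_⟩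
  have hmem : U s x0 ∈ S := by
    have h1 : Set.MapsTo (U s) (convexHull ℝ (Set.range fun s => U s x))
        (convexHull ℝ (Set.range fun s => U s x)) := by
      intro z hz
      have : U s z ∈ U s '' (convexHull ℝ (Set.range fun s => U s x)) := ⟨z, hz, rfl⟩
      have h2 := (U s).toLinearMap.image_convexHull (Set.range fun s => U s x)
      simp only [ContinuousLinearMap.coe_coe] at h2
      rw [h2] at this
      refine convexHull_mono ?_ this
      rintro _ ⟨_, ⟨t, rfl⟩, rfl⟩
      exact ⟨s + t, (hadd s t x).symm⟩
    exact h1.closure (U s).continuous hx0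
  have h := hmin _ hmem
  have h2 := hU s x0
  have h3 : ‖U s x0 - x0‖ ^ 2 ≤ 0 := by
    rw [norm_sub_sq_real]
    rw [zero_sub, inner_neg_left, inner_sub_right, real_inner_self_eq_norm_sq,
      real_inner_comm] at h
    have : ‖U s x0‖ ^ 2 ≤ ‖x0‖ ^ 2 := by gcongr
    linarith
  have h4 : ‖U s x0 - x0‖ = 0 := by
    have := sq_nonneg ‖U s x0 - x0‖
    exact pow_eq_zero_iff (two_ne_zero) |>.1 (le_antisymm h3 this)
  exact sub_eq_zero.1 (norm_eq_zero.1 h4)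

lemma aux_pair {H : Type*} [NormedAddCommGroup H] [InnerProductSpace ℝ H] [CompleteSpace H]
    (U : ℝ → H →ₗᵢ[ℝ] H)
    (hadd : ∀ s t x, U s (U t x) = U (s + t) x) (u w Pu Pw g f : H)
    (hPuK : ∀ s, U s Pu = Pu) (hPwK : ∀ s, U s Pw = Pw)
    (hPu : ∀ k, (∀ s, U s k = k) → inner ℝ (u - Pu) k = 0)
    (hPw : ∀ k, (∀ s, U s k = k) → inner ℝ (w - Pw) k = 0)
    (h : ∀ s, inner ℝ u (U s g) = - inner ℝ w (U s f)) :
    inner ℝ Pu g = - inner ℝ Pw f := by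
  let V : ℝ → WithLp 2 (H × H) →L[ℝ] WithLp 2 (H × H) := fun s =>
    (WithLp.prodContinuousLinearEquiv 2 ℝ H H).symm.toContinuousLinearMap ∘L
      ((U s).toContinuousLinearMap.prodMap (U s).toContinuousLinearMap) ∘L
      (WithLp.prodContinuousLinearEquiv 2 ℝ H H).toContinuousLinearMap
  have hV : ∀ s x, V s x = WithLp.toLp 2 (U s x.fst, U s x.snd) := fun s x => rfl
  obtain ⟨x0, hx0, hinv⟩ := aux_hilbert V
    (fun s x => by rw [hV, WithLp.prod_norm_eq_of_L2, WithLp.prod_norm_eq_of_L2]; simp)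
    (fun s t x => by simp [hV, hadd]) (WithLp.toLp 2 (g, f))
  have key : ∀ p q : H, ∀ r : ℝ, (∀ s, inner ℝ p (U s g) + inner ℝ q (U s f) = r) →
      inner ℝ p x0.fst + inner ℝ q x0.snd = r := by
    intro p q r hr
    let ℓ : WithLp 2 (H × H) →L[ℝ] ℝ := innerSL ℝ (WithLp.toLp 2 (p, q))
    have hℓ : ∀ x, ℓ x = inner ℝ p x.fst + inner ℝ q x.snd := fun x => by
      simp [ℓ, WithLp.prod_inner_apply]
    have hsub : closure (convexHull ℝ (Set.range fun s => V s (WithLp.toLp 2 (g, f)))) ⊆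
        ℓ ⁻¹' {r} := by
      refine closure_minimal (convexHull_min ?_ ?_) (isClosed_singleton.preimage ℓ.continuous)
      · rintro _ ⟨s, rfl⟩
        simp only [Set.mem_preimage, Set.mem_singleton_iff, hℓ, hV]
        exact hr s
      · exact (convex_singleton r).linear_preimage ℓ.toLinearMap
    have := hsub hx0
    simp only [Set.mem_preimage, Set.mem_singleton_iff, hℓ] at this
    exact this
  have hi1 : ∀ s, U s x0.fst = x0.fst := fun s => by
    have := hinv s; rw [hV] at this; exact congrArg WithLp.fst this
  have hi2 : ∀ s, U s x0.snd = x0.snd := fun s => by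
    have := hinv s; rw [hV] at this; exact congrArg WithLp.snd this
  have k1 := key u w 0 (fun s => by rw [h s]; ring)
  have k2 := key Pu Pw (inner ℝ Pu g + inner ℝ Pw f) (fun s => by
    have a1 := (U s).inner_map_map Pu g
    have a2 := (U s).inner_map_map Pw f
    rw [hPuK] at a1; rw [hPwK] at a2; rw [a1, a2])
  have e1 := hPu _ hi1
  have e2 := hPw _ hi2
  rw [inner_sub_left] at e1 e2
  linarith

variable [MeasurableSpace E] [BorelSpace E] (μ : Measure E) [μ.IsAddHaarMeasure]

open scoped Convolution in
lemma aux_moll {c : E → E} (hc : Continuous c) {u w : E → ℝ}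
    (hu : LocallyIntegrable u μ) (hw : LocallyIntegrable w μ)
    (huw : ∀ φ : E → ℝ, ContDiff ℝ 1 φ → HasCompactSupport φ →
      ∫ y, u y * fderiv ℝ φ y (c y) ∂μ = - ∫ y, w y * φ y ∂μ)
    {ψ G : E → ℝ} {L : NNReal} (hψL : LipschitzWith L ψ) (hψ : HasCompactSupport ψ)
    (hG : ∀ y, (fun p : E × ℝ => ψ (p.1 + p.2 • c y) - ψ p.1 - p.2 * G y) =o[𝓝 (y, 0)]
      (fun p => p.2)) :
    ∫ y, u y * G y ∂μ = - ∫ y, w y * ψ y ∂μ := by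
  have hψc : Continuous ψ := hψL.continuous
  let ρ : ℕ → ContDiffBump (0 : E) := fun n =>
    ⟨1 / (2 * ((n:ℝ) + 1)), 1 / ((n:ℝ) + 1), by positivity, by
      apply one_div_lt_one_div_of_lt <;> linarith [(n.cast_nonneg : (0:ℝ) ≤ n)]⟩
  have hρout : Tendsto (fun n => (ρ n).rOut) atTop (𝓝 0) := tendsto_one_div_add_atTop_nhds_zero_nat
  have hρ1 : ∀ n, (ρ n).rOut ≤ 1 := fun n => by
    change 1 / ((n:ℝ) + 1) ≤ 1
    rw [div_le_one (by positivity)]; linarith [(n.cast_nonneg : (0:ℝ) ≤ n)]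
  let Ψ : ℕ → E → ℝ := fun n => (ρ n).normed μ ⋆[ContinuousLinearMap.lsmul ℝ ℝ, μ] ψ
  have hΨ1 : ∀ n, ContDiff ℝ 1 (Ψ n) := fun n =>
    (ρ n).hasCompactSupport_normed.contDiff_convolution_left (n := 1) _ (ρ n).contDiff_normed
      hψc.locallyIntegrable
  have hΨs : ∀ n, HasCompactSupport (Ψ n) := fun n =>
    (ρ n).hasCompactSupport_normed.convolution _ hψ
  have hconv : ∀ n (v : E) x, ((ρ n).normed μ ⋆[ContinuousLinearMap.lsmul ℝ ℝ, μ]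
      (fun x => ψ (x + v) - ψ x)) x = Ψ n (x + v) - Ψ n x := by
    intro n v x
    have hex : ∀ x, Integrable (fun t => (ρ n).normed μ t • ψ (x - t)) μ := fun x =>
      (((ρ n).continuous_normed).smul (hψc.comp (continuous_const.sub continuous_id))
        ).integrable_of_hasCompactSupport (ρ n).hasCompactSupport_normed.smul_right
    simp only [Ψ, convolution_lsmul]
    rw [← integral_sub (hex _) (hex _)]
    congr 1; ext t
    rw [smul_sub, sub_add_eq_add_sub]
  have hdist : ∀ n (v x : E) (z ε : ℝ), 0 ≤ ε →
      (∀ x' ∈ Metric.ball x (ρ n).rOut, |ψ (x' + v) - ψ x' - z| ≤ ε) →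
      |Ψ n (x + v) - Ψ n x - z| ≤ ε := by
    intro n v x z ε hε h
    have := dist_convolution_le (μ := μ) (f := (ρ n).normed μ) (g := fun x => ψ (x + v) - ψ x)
      (x₀ := x) (R := (ρ n).rOut) (z₀ := z) hε (by rw [(ρ n).support_normed_eq])
      (ρ n).nonneg_normed (ρ n).integral_normed
      (by have : Continuous (fun x => ψ (x + v) - ψ x) := by fun_prop
          exact this.aestronglyMeasurable) (fun x' hx' => by rw [Real.dist_eq]; exact h x' hx')
    rwa [hconv, Real.dist_eq] at this
  have hΨL : ∀ n, LipschitzWith L (Ψ n) := fun n => LipschitzWith.of_dist_le_mul fun x y => by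
    have := hdist n (x - y) y 0 (L * dist x y) (by positivity) (fun x' _ => by
      have := hψL.dist_le_mul (x' + (x - y)) x'
      rw [Real.dist_eq] at this
      simpa [dist_eq_norm] using this)
    rw [Real.dist_eq]
    simpa using this
  -- pointwise convergence of the derivatives
  have hder : ∀ y, Tendsto (fun n => fderiv ℝ (Ψ n) y (c y)) atTop (𝓝 (G y)) := by
    intro y
    rw [Metric.tendsto_atTop']
    intro ε hε
    have h := (Asymptotics.isLittleO_iff.1 (hG y)) (half_pos hε)
    obtain ⟨δ, hδ, h⟩ := Metric.eventually_nhds_iff_ball.1 h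
    obtain ⟨N, hN⟩ := (Metric.tendsto_atTop.1 hρout) δ hδ
    refine ⟨N, fun n hn => ?_⟩
    have hr : (ρ n).rOut < δ := by
      have := hN n hn.le
      rw [Real.dist_eq, sub_zero] at this
      exact (le_abs_self _).trans_lt this
    have hD : HasDerivAt (fun t : ℝ => Ψ n (y + t • c y) - t * G y)
        (fderiv ℝ (Ψ n) y (c y) - G y) 0 := by
      have h1 : HasFDerivAt (Ψ n) (fderiv ℝ (Ψ n) y) (y + (0:ℝ) • c y) := by
        simpa using ((hΨ1 n).differentiable (by norm_num) y).hasFDerivAt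
      have h2 : HasDerivAt (fun t : ℝ => y + t • c y) (c y) 0 := by
        simpa using ((hasDerivAt_id (0:ℝ)).smul_const (c y)).const_add y
      have h3 := h1.comp_hasDerivAt (0:ℝ) h2
      have h4 : HasDerivAt (fun t : ℝ => t * G y) (G y) 0 := by
        simpa using (hasDerivAt_id (0:ℝ)).mul_const (G y)
      exact h3.sub h4
    have hle : ‖fderiv ℝ (Ψ n) y (c y) - G y‖ ≤ ε / 2 := by
      refine hD.le_of_lip' (half_pos hε).le ?_
      filter_upwards [Metric.ball_mem_nhds (0:ℝ) hδ] with t ht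
      have := hdist n (t • c y) y (t * G y) (ε / 2 * |t|) (by positivity) (fun x' hx' => by
        have := h (x', t) (by
          rw [Metric.mem_ball] at hx' ht ⊢
          rw [Prod.dist_eq]
          exact max_lt (hx'.trans hr) ht)
        simpa using this)
      simp only [Real.norm_eq_abs, sub_zero, zero_smul, add_zero, zero_mul]
      convert this using 2
      ring
    rw [dist_eq_norm]
    linarith
  have hval : ∀ y, Tendsto (fun n => Ψ n y) atTop (𝓝 (ψ y)) := fun y =>
    ContDiffBump.convolution_tendsto_right_of_continuous hρout hψc y
  -- supports
  obtain ⟨R, hR⟩ := hψ.isCompact.isBounded.subset_closedBall 0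
  have hz : ∀ n y, y ∉ Metric.closedBall (0:E) (R + 1) → Ψ n y = 0 := by
    intro n y hy
    by_contra hne
    have := support_convolution_subset_swap (L := ContinuousLinearMap.lsmul ℝ ℝ) (μ := μ)
      (f := (ρ n).normed μ) (g := ψ) hne
    obtain ⟨a, ha, d, hd, rfl⟩ := Set.mem_add.1 this
    rw [(ρ n).support_normed_eq] at hd
    have ha' := hR (subset_tsupport _ ha)
    simp only [Metric.mem_closedBall, Metric.mem_ball, dist_zero_right] at ha' hd hy
    exact hy ((norm_add_le _ _).trans (by linarith [hρ1 n]))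
  have hzd : ∀ n y, y ∉ Metric.closedBall (0:E) (R + 1) → fderiv ℝ (Ψ n) y = 0 := by
    intro n y hy
    have : Ψ n =ᶠ[𝓝 y] fun _ => 0 := by
      filter_upwards [Metric.isClosed_closedBall.isOpen_compl.mem_nhds hy] with x hx
      exact hz n x hx
    rw [this.fderiv_eq]; simp
  have hB : MeasurableSet (Metric.closedBall (0:E) (R + 1)) := measurableSet_closedBall
  have hBc := isCompact_closedBall (0:E) (R + 1)
  obtain ⟨M, hM⟩ := hBc.exists_bound_of_continuousOn hc.continuousOn
  have hdc : ∀ n, Continuous fun y => fderiv ℝ (Ψ n) y (c y) := fun n =>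
    ((hΨ1 n).continuous_fderiv (by norm_num)).clm_apply hc
  have T1 : Tendsto (fun n => ∫ y, u y * fderiv ℝ (Ψ n) y (c y) ∂μ) atTop
      (𝓝 (∫ y, u y * G y ∂μ)) := by
    refine tendsto_integral_of_dominated_convergence
      ((Metric.closedBall (0:E) (R + 1)).indicator fun y => ‖u y‖ * (L * |M|)) (fun n =>
        hu.aestronglyMeasurable.mul (hdc n).aestronglyMeasurable)
      ((integrable_indicator_iff hB).2 ((hu.integrableOn_isCompact hBc).norm.mul_const _))
      (fun n => Eventually.of_forall fun y => ?_)
      (Eventually.of_forall fun y => (hder y).const_mul _)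
    by_cases hy : y ∈ Metric.closedBall (0:E) (R + 1)
    · rw [Set.indicator_of_mem hy, norm_mul]
      gcongr
      refine (ContinuousLinearMap.le_opNorm _ _).trans ?_
      gcongr
      · exact norm_fderiv_le_of_lipschitz ℝ (hΨL n)
      · exact (hM y hy).trans (le_abs_self _)
    · rw [Set.indicator_of_notMem hy, hzd n y hy]; simp
  obtain ⟨M', hM'⟩ := hψ.exists_bound_of_continuous hψc
  have T2 : Tendsto (fun n => ∫ y, w y * Ψ n y ∂μ) atTop (𝓝 (∫ y, w y * ψ y ∂μ)) := by
    refine tendsto_integral_of_dominated_convergence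
      ((Metric.closedBall (0:E) (R + 1)).indicator fun y => ‖w y‖ * (M' + L)) (fun n =>
        hw.aestronglyMeasurable.mul (hΨ1 n).continuous.aestronglyMeasurable)
      ((integrable_indicator_iff hB).2 ((hw.integrableOn_isCompact hBc).norm.mul_const _))
      (fun n => Eventually.of_forall fun y => ?_)
      (Eventually.of_forall fun y => (hval y).const_mul _)
    by_cases hy : y ∈ Metric.closedBall (0:E) (R + 1)
    · rw [Set.indicator_of_mem hy, norm_mul]
      gcongr
      have := dist_convolution_le (μ := μ) (f := (ρ n).normed μ) (g := ψ)
        (x₀ := y) (R := (ρ n).rOut) (z₀ := 0) (ε := M' + L)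
        (add_nonneg ((norm_nonneg _).trans (hM' 0)) L.2) (by rw [(ρ n).support_normed_eq])
        (ρ n).nonneg_normed (ρ n).integral_normed hψc.aestronglyMeasurable (fun x' hx' => by
          rw [dist_zero_right]; exact (hM' x').trans (by linarith [L.2]))
      rwa [dist_zero_right] at this
    · rw [Set.indicator_of_notMem hy, hz n y hy]; simp
  refine tendsto_nhds_unique T1 ?_
  simp_rw [huw _ (hΨ1 _) (hΨs _)]
  exact T2.neg

end moll

section comp
variable {E : Type*} [NormedAddCommGroup E] [NormedSpace ℝ E] [FiniteDimensional ℝ E]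

lemma aux_bound' {b : E → E} {C : ℝ} (hgrow : ∀ y, ‖b y‖ ≤ C * (1 + ‖y‖)) (hC : 0 < C)
    {Y : ℝ → E → E} (hY0 : ∀ y, Y 0 y = y)
    (hYd : ∀ s y, HasDerivAt (fun t => Y t y) (b (Y s y)) s) (R t : ℝ) :
    ∃ R', 0 ≤ R' ∧ ∀ y, ‖y‖ ≤ R → ‖Y t y‖ ≤ R' := by
  rcases le_total 0 t with ht | ht
  · obtain ⟨R', h0, h⟩ := aux_bound hgrow hC hY0 hYd R t
    exact ⟨R', h0, fun y hy => h y hy t ⟨ht, le_rfl⟩⟩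
  · obtain ⟨R', h0, h⟩ := aux_bound (b := fun y => - b y) (Y := fun t => Y (-t))
      (by simpa using hgrow) hC (by simpa using hY0) (aux_rev hYd) R (-t)
    exact ⟨R', h0, fun y hy => by simpa using h y hy (-t) ⟨by linarith, le_rfl⟩⟩

lemma aux_lipflow' {b : E → E} (hb : ContDiff ℝ 1 b) {C : ℝ}
    (hgrow : ∀ y, ‖b y‖ ≤ C * (1 + ‖y‖)) (hC : 0 < C)
    {Y : ℝ → E → E} (hY0 : ∀ y, Y 0 y = y)
    (hYd : ∀ s y, HasDerivAt (fun t => Y t y) (b (Y s y)) s) (R t : ℝ) :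
    ∃ L : NNReal, LipschitzOnWith L (Y t) (Metric.closedBall 0 R) := by
  rcases le_total 0 t with ht | ht
  · exact aux_lipflow hb hgrow hC hY0 hYd R t ht
  · simpa using aux_lipflow (b := fun y => - b y) (Y := fun t => Y (-t)) hb.neg
      (by simpa using hgrow) hC (by simpa using hY0) (aux_rev hYd) R (-t) (by linarith)

lemma aux_star' {b c : E → E} (hb : ContDiff ℝ 1 b) (hcc : ContDiff ℝ 1 c) {C : ℝ}
    (hgrow : ∀ y, ‖b y‖ ≤ C * (1 + ‖y‖)) (hC : 0 < C)
    {Y : ℝ → E → E} (hY0 : ∀ y, Y 0 y = y)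
    (hYd : ∀ s y, HasDerivAt (fun t => Y t y) (b (Y s y)) s)
    (hbc : ∀ y, fderiv ℝ c y (b y) - fderiv ℝ b y (c y) = 0) (t : ℝ) (y : E) :
    (fun p : E × ℝ => Y t (p.1 + p.2 • c y) - Y t p.1 - p.2 • c (Y t y)) =o[𝓝 (y, 0)]
      (fun p => p.2) := by
  rcases le_total 0 t with ht | ht
  · exact aux_star hb hcc hgrow hC hY0 hYd hbc t ht y
  · have := aux_star (b := fun y => - b y) (c := c) (Y := fun t => Y (-t)) hb.neg hcc
      (by simpa using hgrow) hC (by simpa using hY0) (aux_rev hYd) (fun z => by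
        have h1 := hbc z
        rw [fderiv_fun_neg, map_neg, _root_.neg_apply, sub_neg_eq_add,
          neg_add_eq_sub, ← neg_sub, h1, neg_zero]) (-t) (by linarith) y
    simpa using this

lemma aux_lipglobal {ψ : E → ℝ} (hψc : Continuous ψ) (hψ : HasCompactSupport ψ)
    (h : ∀ R, ∃ L : NNReal, LipschitzOnWith L ψ (Metric.closedBall 0 R)) :
    ∃ L : NNReal, LipschitzWith L ψ := by
  obtain ⟨R, hR⟩ := hψ.isCompact.isBounded.subset_closedBall 0
  obtain ⟨L, hL⟩ := h (R + 1)
  obtain ⟨M, hM⟩ := hψ.exists_bound_of_continuous hψc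
  have hM0 : 0 ≤ M := (norm_nonneg _).trans (hM 0)
  have hz : ∀ x, R < ‖x‖ → ψ x = 0 := fun x hx => by
    by_contra hne
    have := hR (subset_tsupport _ hne)
    simp at this; linarith
  have hout : ∀ x y, R + 1 < ‖x‖ → dist (ψ x) (ψ y) ≤ max (L:ℝ) M * dist x y := by
    intro x y hx
    have hx0 := hz x (by linarith)
    rcases lt_or_ge R ‖y‖ with hy | hy
    · rw [hx0, hz y hy, dist_self]; positivity
    · have h1 : 1 ≤ dist x y := by
        rw [dist_eq_norm]; have := norm_sub_norm_le x y; linarith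
      rw [hx0, dist_zero_left]
      calc ‖ψ y‖ ≤ M := hM y
        _ ≤ max (L:ℝ) M := le_max_right _ _
        _ ≤ max (L:ℝ) M * dist x y := le_mul_of_one_le_right (hM0.trans (le_max_right _ _)) h1
  refine ⟨(max (L:ℝ) M).toNNReal, LipschitzWith.of_dist_le_mul fun x y => ?_⟩
  rw [Real.coe_toNNReal _ (hM0.trans (le_max_right _ _))]
  rcases lt_or_ge (R + 1) ‖x‖ with hx | hx
  · exact hout x y hx
  rcases lt_or_ge (R + 1) ‖y‖ with hy | hy
  · rw [dist_comm, dist_comm x]; exact hout y x hy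
  refine (hL.dist_le_mul x (by simpa using hx) y (by simpa using hy)).trans ?_
  gcongr
  exact le_max_left _ _

lemma aux_comp [MeasurableSpace E] [BorelSpace E] (μ : Measure E) [μ.IsAddHaarMeasure]
    {b c : E → E} (hb : ContDiff ℝ 1 b) (hcc : ContDiff ℝ 1 c) {C : ℝ}
    (hgrow : ∀ y, ‖b y‖ ≤ C * (1 + ‖y‖)) (hC : 0 < C)
    {Y : ℝ → E → E} (hY0 : ∀ y, Y 0 y = y)
    (hYd : ∀ s y, HasDerivAt (fun t => Y t y) (b (Y s y)) s)
    (hbc : ∀ y, fderiv ℝ c y (b y) - fderiv ℝ b y (c y) = 0)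
    {u w : E → ℝ} (hu : LocallyIntegrable u μ) (hw : LocallyIntegrable w μ)
    (huw : ∀ φ : E → ℝ, ContDiff ℝ 1 φ → HasCompactSupport φ →
      ∫ y, u y * fderiv ℝ φ y (c y) ∂μ = - ∫ y, w y * φ y ∂μ)
    {φ : E → ℝ} (hφ : ContDiff ℝ 1 φ) (hφs : HasCompactSupport φ) (t : ℝ) :
    ∫ y, u y * fderiv ℝ φ (Y t y) (c (Y t y)) ∂μ = - ∫ y, w y * φ (Y t y) ∂μ := by
  have hYc : Continuous (Y t) := continuous_iff_continuousAt.2 fun y => by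
    obtain ⟨L, hL⟩ := aux_lipflow' hb hgrow hC hY0 hYd (‖y‖ + 1) t
    exact hL.continuousOn.continuousAt (Metric.closedBall_mem_nhds_of_mem (by simp))
  have hψc : Continuous (fun y => φ (Y t y)) := hφ.continuous.comp hYc
  have hψs : HasCompactSupport (fun y => φ (Y t y)) := by
    obtain ⟨R, hR⟩ := hφs.isCompact.isBounded.subset_closedBall 0
    obtain ⟨R', -, hR'⟩ := aux_bound' hgrow hC hY0 hYd R (-t)
    refine HasCompactSupport.intro (isCompact_closedBall (0:E) R') fun x hx => ?_
    by_contra hne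
    apply hx
    have h1 := hR (subset_tsupport φ hne)
    have h2 := hR' (Y t x) (by simpa using h1)
    rw [aux_group hb hY0 hYd, neg_add_cancel, hY0] at h2
    simpa using h2
  obtain ⟨L, hL⟩ := aux_lipglobal hψc hψs (fun R => by
    obtain ⟨L1, h1⟩ := aux_lipflow' hb hgrow hC hY0 hYd R t
    obtain ⟨R', -, hR'⟩ := aux_bound' hgrow hC hY0 hYd R t
    obtain ⟨L2, h2⟩ := aux_lip hφ R'
    exact ⟨L2 * L1, h2.comp h1 (fun x hx => by simpa using hR' x (by simpa using hx))⟩)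
  refine aux_moll μ hcc.continuous hu hw huw hL hψs (fun y => ?_)
  have hs := aux_star' hb hcc hgrow hC hY0 hYd hbc t y
  have hst : HasStrictFDerivAt φ (fderiv ℝ φ (Y t y)) (Y t y) :=
    hφ.contDiffAt.hasStrictFDerivAt (by norm_num)
  have hT : Tendsto (fun p : E × ℝ => (Y t (p.1 + p.2 • c y), Y t p.1)) (𝓝 (y, 0))
      (𝓝 (Y t y, Y t y)) := by
    have : Continuous (fun p : E × ℝ => (Y t (p.1 + p.2 • c y), Y t p.1)) := by fun_prop
    have := this.tendsto (y, 0)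
    simpa using this
  have h1 := hst.isLittleO.comp_tendsto hT
  have hO : (fun p : E × ℝ => Y t (p.1 + p.2 • c y) - Y t p.1) =O[𝓝 (y, 0)]
      (fun p => p.2) := by
    have h2 : (fun p : E × ℝ => p.2 • c (Y t y)) =O[𝓝 (y, 0)] (fun p => p.2) := by
      refine Asymptotics.IsBigO.of_bound ‖c (Y t y)‖ (Eventually.of_forall fun p => ?_)
      rw [norm_smul, mul_comm]
    simpa using hs.isBigO.add h2
  have h3 := h1.trans_isBigO hO
  have h4 := (fderiv ℝ φ (Y t y)).isBigO_comp (fun p : E × ℝ => Y t (p.1 + p.2 • c y) - Y t p.1 - p.2 • c (Y t y)) (𝓝 (y,0))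
  have h5 := h3.add (h4.trans_isLittleO hs)
  refine h5.congr_left fun p => ?_
  simp [map_sub]

end comp

/-- Let `b` be a `C¹` divergence-free vector field with linear growth and
measure-preserving flow `Y`, `K ⊆ L²(ℝ^m)` the subspace of functions invariant along the
flow, and `⟨·⟩` the orthogonal projection onto `K` (encoded by `Pu`, `Pw` together with the
orthogonality relations).  Let `c` be a `C¹` vector field with bounded divergence, in
involution with `b` (`[b,c] = 0`).  If `u, w ∈ L²` satisfy
`∫ u (c·∇φ) dy = −∫ w φ dy` for all `φ ∈ C¹_c` (i.e. `div(uc) = w` in distributions), then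
`∫ ⟨u⟩ (c·∇φ) dy = −∫ ⟨w⟩ φ dy` for all `φ ∈ C¹_c` (i.e. `div(⟨u⟩c) = ⟨div(uc)⟩`). -/
theorem average_commutes_with_first_order_operator
    (m : ℕ) (hm : 1 ≤ m)
    (b : (Fin m → ℝ) → (Fin m → ℝ)) (hb : ContDiff ℝ 1 b)
    (C : ℝ) (hC : 0 < C) (hgrow : ∀ y, ‖b y‖ ≤ C * (1 + ‖y‖))
    (hdivb : ∀ y, ∑ i, fderiv ℝ (fun z => b z i) y (Pi.single i (1:ℝ)) = 0)
    (Y : ℝ → (Fin m → ℝ) → (Fin m → ℝ))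
    (hY0 : ∀ y, Y 0 y = y)
    (hYd : ∀ (s : ℝ) (y : Fin m → ℝ), HasDerivAt (fun t => Y t y) (b (Y s y)) s)
    (hYmp : ∀ s : ℝ, MeasurePreserving (Y s) (volume : Measure (Fin m → ℝ)) volume)
    (K : Submodule ℝ (Lp ℝ 2 (volume : Measure (Fin m → ℝ))))
    (hK : ∀ v : Lp ℝ 2 (volume : Measure (Fin m → ℝ)),
      v ∈ K ↔ ∀ s : ℝ, (fun y => v (Y s y)) =ᵐ[(volume : Measure (Fin m → ℝ))] v)
    (c : (Fin m → ℝ) → (Fin m → ℝ)) (hc : ContDiff ℝ 1 c)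
    (hcdiv : ∃ M : ℝ, ∀ y, |∑ i, fderiv ℝ (fun z => c z i) y (Pi.single i (1:ℝ))| ≤ M)
    (hbc : ∀ y, fderiv ℝ c y (b y) - fderiv ℝ b y (c y) = 0)
    (u w : Lp ℝ 2 (volume : Measure (Fin m → ℝ)))
    (huw : ∀ φ : (Fin m → ℝ) → ℝ, ContDiff ℝ 1 φ → HasCompactSupport φ →
      ∫ y, u y * fderiv ℝ φ y (c y) ∂(volume : Measure (Fin m → ℝ))
        = - ∫ y, w y * φ y ∂(volume : Measure (Fin m → ℝ)))
    (Pu Pw : Lp ℝ 2 (volume : Measure (Fin m → ℝ)))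
    (hPuK : Pu ∈ K)
    (hPu : ∀ φ ∈ K, ∫ y, (u y - Pu y) * φ y ∂(volume : Measure (Fin m → ℝ)) = 0)
    (hPwK : Pw ∈ K)
    (hPw : ∀ φ ∈ K, ∫ y, (w y - Pw y) * φ y ∂(volume : Measure (Fin m → ℝ)) = 0) :
    ∀ φ : (Fin m → ℝ) → ℝ, ContDiff ℝ 1 φ → HasCompactSupport φ →
      ∫ y, Pu y * fderiv ℝ φ y (c y) ∂(volume : Measure (Fin m → ℝ))
        = - ∫ y, Pw y * φ y ∂(volume : Measure (Fin m → ℝ)) := by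
  intro φ hφ hφs
  have huL : LocallyIntegrable u (volume : Measure (Fin m → ℝ)) :=
    (Lp.memLp u).locallyIntegrable (by norm_num)
  have hwL : LocallyIntegrable w (volume : Measure (Fin m → ℝ)) :=
    (Lp.memLp w).locallyIntegrable (by norm_num)
  have key := aux_comp volume hb hc hgrow hC hY0 hYd hbc huL hwL huw hφ hφs
  have hgc : Continuous fun y => fderiv ℝ φ y (c y) :=
    (hφ.continuous_fderiv (by norm_num)).clm_apply hc.continuous
  have hgs : HasCompactSupport fun y => fderiv ℝ φ y (c y) := by
    refine (hφs.fderiv (𝕜 := ℝ)).mono fun y hy => ?_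
    rw [Function.mem_support] at hy ⊢
    intro h; exact hy (by rw [h]; rfl)
  have hgL : MemLp (fun y => fderiv ℝ φ y (c y)) 2 (volume : Measure (Fin m → ℝ)) :=
    hgc.memLp_of_hasCompactSupport hgs
  have hfL : MemLp φ 2 (volume : Measure (Fin m → ℝ)) :=
    hφ.continuous.memLp_of_hasCompactSupport hφs
  let U : ℝ → Lp ℝ 2 (volume : Measure (Fin m → ℝ)) →ₗᵢ[ℝ] Lp ℝ 2 (volume : Measure (Fin m → ℝ)) :=
    fun s => Lp.compMeasurePreservingₗᵢ ℝ (Y s) (hYmp s)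
  have hUae : ∀ s v, U s v =ᵐ[volume] fun y => v (Y s y) := fun s v =>
    Lp.coeFn_compMeasurePreserving v (hYmp s)
  have hinner : ∀ p q : Lp ℝ 2 (volume : Measure (Fin m → ℝ)),
      inner ℝ p q = ∫ y, p y * q y := fun p q => by
    rw [L2.inner_def]
    refine integral_congr_ae (Eventually.of_forall fun y => ?_)
    simp [mul_comm]
  have hinv : ∀ v, v ∈ K ↔ ∀ s, U s v = v := fun v => by
    rw [hK]
    refine forall_congr' fun s => ⟨fun h => Lp.ext ((hUae s v).trans h), fun h => ?_⟩
    have := hUae s v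
    rw [h] at this
    exact this.symm
  have hproj : ∀ p Pp : Lp ℝ 2 (volume : Measure (Fin m → ℝ)),
      (∀ φ ∈ K, ∫ y, (p y - Pp y) * φ y = 0) → ∀ k, (∀ s, U s k = k) → inner ℝ (p - Pp) k = 0 := by
    intro p Pp h k hk
    rw [hinner, ← h k ((hinv k).2 hk)]
    refine integral_congr_ae ?_
    filter_upwards [Lp.coeFn_sub p Pp] with y hy
    rw [hy]; rfl
  have main := aux_pair U (fun s t v => by
      refine Lp.ext ?_
      refine (hUae s _).trans (((hYmp s).quasiMeasurePreserving.ae_eq_comp (hUae t v)).trans ?_)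
      refine EventuallyEq.trans ?_ (hUae (s + t) v).symm
      refine Eventually.of_forall fun y => ?_
      simp only [Function.comp]
      rw [aux_group hb hY0 hYd, add_comm]) u w Pu Pw (hgL.toLp _) (hfL.toLp _)
    ((hinv _).1 hPuK) ((hinv _).1 hPwK) (hproj u Pu hPu) (hproj w Pw hPw) (fun s => by
      rw [hinner, hinner]
      have e1 : ∫ y, u y * (U s (hgL.toLp _)) y = ∫ y, u y * fderiv ℝ φ (Y s y) (c (Y s y)) := by
        refine integral_congr_ae ?_
        filter_upwards [hUae s (hgL.toLp _),
          (hYmp s).quasiMeasurePreserving.ae_eq_comp hgL.coeFn_toLp] with y h1 h2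
        rw [h1]; simp only [Function.comp] at h2; rw [h2]
      have e2 : ∫ y, w y * (U s (hfL.toLp _)) y = ∫ y, w y * φ (Y s y) := by
        refine integral_congr_ae ?_
        filter_upwards [hUae s (hfL.toLp _),
          (hYmp s).quasiMeasurePreserving.ae_eq_comp hfL.coeFn_toLp] with y h1 h2
        rw [h1]; simp only [Function.comp] at h2; rw [h2]
      rw [e1, e2]
      exact key s)
  rw [hinner, hinner] at main
  have e1 : ∫ y, Pu y * (hgL.toLp _) y = ∫ y, Pu y * fderiv ℝ φ y (c y) := by
    refine integral_congr_ae ?_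
    filter_upwards [hgL.coeFn_toLp] with y h1
    rw [h1]
  have e2 : ∫ y, Pw y * (hfL.toLp _) y = ∫ y, Pw y * φ y := by
    refine integral_congr_ae ?_
    filter_upwards [hfL.coeFn_toLp] with y h1
    rw [h1]
  rw [e1, e2] at main
  exact main
end

section
/- Let A : ℝ^m → M_m(ℝ) be a C¹ matrix field. Then [b,A] := (b·∇_y)A − (∂_yb) A − A ᵗ(∂_yb) vanishes identically on ℝ^m if and only if A(Y(s;y)) = ∂_yY(s;y) A(y) ᵗ∂_yY(s;y) for all s ∈ ℝ and all y ∈ ℝ^m. -/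
open MeasureTheory Matrix
open Set Filter Topology

lemma aux_fwd {E : Type*} [NormedAddCommGroup E] [NormedSpace ℝ E] [FiniteDimensional ℝ E]
    (b : E → E) (hb : ContDiff ℝ 1 b)
    (C : ℝ) (hC : 0 < C) (hgrow : ∀ y, ‖b y‖ ≤ C * (1 + ‖y‖))
    (Y : ℝ → E → E)
    (hY0 : ∀ y, Y 0 y = y)
    (hYd : ∀ (s : ℝ) (y : E), HasDerivAt (fun t => Y t y) (b (Y s y)) s)
    (T : ℝ) (y v : E) :
    ∃ G : ℝ, ∀ s ∈ Icc 0 T, ∀ e : ℝ, |e| ≤ 1 →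
      ‖b (Y s (y + e • v)) - b (Y s y)‖ ≤ G * |e| := by
  have hcont : ∀ z, Continuous (fun t => Y t z) := fun z =>
    continuous_iff_continuousAt.2 fun s => (hYd s z).continuousAt
  set R := gronwallBound (‖y‖ + ‖v‖) C C T with hR
  have hbd : ∀ e : ℝ, |e| ≤ 1 → ∀ s ∈ Icc 0 T, Y s (y + e • v) ∈ Metric.closedBall (0:E) R := by
    intro e he s hs
    have h1 := norm_le_gronwallBound_of_norm_deriv_right_le (f := fun t => Y t (y + e • v))
      (f' := fun t => b (Y t (y + e • v))) (δ := ‖y‖ + ‖v‖) (K := C) (ε := C) (a := 0) (b := T)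
      (hcont _).continuousOn (fun x _ => (hYd x _).hasDerivWithinAt)
      (by
        rw [hY0]
        refine (norm_add_le _ _).trans ?_
        rw [norm_smul, Real.norm_eq_abs]
        have := mul_le_mul_of_nonneg_right he (norm_nonneg v)
        linarith)
      (fun x _ => by
        have := hgrow (Y x (y + e • v))
        linarith) s hs
    rw [mem_closedBall_zero_iff]
    refine h1.trans ?_
    exact gronwallBound_mono (by positivity) hC.le hC.le (by linarith [hs.2])
  obtain ⟨K, hK⟩ := (isCompact_closedBall (0:E) R).exists_bound_of_continuousOn
    ((hb.continuous_fderiv (by norm_num)).continuousOn)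
  have hlip : LipschitzOnWith K.toNNReal b (Metric.closedBall (0:E) R) := by
    apply Convex.lipschitzOnWith_of_nnnorm_fderiv_le (𝕜 := ℝ)
      (fun x _ => (hb.differentiable (by norm_num)) x)
      (fun x hx => ?_) (convex_closedBall _ _)
    exact NNReal.le_toNNReal_of_coe_le (hK x hx)
  have hy : ∀ s ∈ Icc 0 T, Y s y ∈ Metric.closedBall (0:E) R := by
    intro s hs
    simpa using hbd 0 (by simp) s hs
  refine ⟨K.toNNReal * (‖v‖ * Real.exp (K.toNNReal * T)), fun s hs e he => ?_⟩
  have h2 := dist_le_of_trajectories_ODE_of_mem (v := fun _ => b) (K := K.toNNReal)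
    (s := fun _ => Metric.closedBall (0:E) R) (f := fun t => Y t (y + e • v))
    (g := fun t => Y t y) (a := 0) (b := T) (δ := |e| * ‖v‖)
    (fun _ _ => hlip) (hcont _).continuousOn (fun x _ => (hYd x _).hasDerivWithinAt)
    (fun t ht => hbd e he t (Ico_subset_Icc_self ht))
    (hcont _).continuousOn (fun x _ => (hYd x _).hasDerivWithinAt)
    (fun t ht => hy t (Ico_subset_Icc_self ht))
    (by simp [hY0, norm_smul]) s hs
  have h3 := hlip.dist_le_mul _ (hbd e he s hs) _ (hy s hs)
  rw [← dist_eq_norm]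
  refine h3.trans ?_
  have h4 : Real.exp (K.toNNReal * (s - 0)) ≤ Real.exp (K.toNNReal * T) := by
    apply Real.exp_le_exp.2
    have := hs.2
    gcongr
    linarith
  calc _ ≤ (K.toNNReal : ℝ) * (|e| * ‖v‖ * Real.exp (K.toNNReal * (s - 0))) := by gcongr
    _ ≤ (K.toNNReal : ℝ) * (|e| * ‖v‖ * Real.exp (K.toNNReal * T)) := by gcongr
    _ = _ := by ring

lemma aux_both {E : Type*} [NormedAddCommGroup E] [NormedSpace ℝ E] [FiniteDimensional ℝ E]
    (b : E → E) (hb : ContDiff ℝ 1 b)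
    (C : ℝ) (hC : 0 < C) (hgrow : ∀ y, ‖b y‖ ≤ C * (1 + ‖y‖))
    (Y : ℝ → E → E)
    (hY0 : ∀ y, Y 0 y = y)
    (hYd : ∀ (s : ℝ) (y : E), HasDerivAt (fun t => Y t y) (b (Y s y)) s)
    (T : ℝ) (y v : E) :
    ∃ G : ℝ, ∀ s, |s| ≤ T → ∀ e : ℝ, |e| ≤ 1 →
      ‖b (Y s (y + e • v)) - b (Y s y)‖ ≤ G * |e| := by
  obtain ⟨G1, h1⟩ := aux_fwd b hb C hC hgrow Y hY0 hYd T y v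
  obtain ⟨G2, h2⟩ := aux_fwd (fun z => - b z) hb.neg C hC (by simpa using hgrow)
    (fun s z => Y (-s) z) (by simpa using hY0)
    (fun s z => by
      have := (hYd (-s) z).scomp s (hasDerivAt_neg s)
      simpa [Function.comp_def] using this) T y v
  refine ⟨max G1 G2, fun s hs e he => ?_⟩
  rcases le_total 0 s with h | h
  · refine (h1 s ⟨h, (le_abs_self s).trans hs⟩ e he).trans ?_
    gcongr
    exact le_max_left _ _
  · have := h2 (-s) ⟨by linarith, (neg_le_abs s).trans hs⟩ e he
    simp only [neg_neg] at this
    rw [← norm_neg, show -(b (Y s (y + e • v)) - b (Y s y)) =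
      -b (Y s (y + e • v)) - -b (Y s y) by abel]
    refine this.trans ?_
    gcongr
    exact le_max_right _ _

lemma aux_var {E : Type*} [NormedAddCommGroup E] [NormedSpace ℝ E] [FiniteDimensional ℝ E]
    (b : E → E) (hb : ContDiff ℝ 1 b)
    (C : ℝ) (hC : 0 < C) (hgrow : ∀ y, ‖b y‖ ≤ C * (1 + ‖y‖))
    (Y : ℝ → E → E)
    (hY0 : ∀ y, Y 0 y = y)
    (hYd : ∀ (s : ℝ) (y : E), HasDerivAt (fun t => Y t y) (b (Y s y)) s)
    (hYs : ∀ s : ℝ, ContDiff ℝ 1 (Y s)) (y v : E) (s : ℝ) :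
    HasDerivAt (fun t => fderiv ℝ (Y t) y v) (fderiv ℝ b (Y s y) (fderiv ℝ (Y s) y v)) s := by
  have hcont : ∀ z, Continuous (fun t => Y t z) := fun z =>
    continuous_iff_continuousAt.2 fun s => (hYd s z).continuousAt
  let e : ℕ → ℝ := fun n => 1 / ((n:ℝ) + 1)
  have he0 : ∀ n, 0 < e n := fun n => by positivity
  have he1 : ∀ n, |e n| ≤ 1 := fun n => by
    rw [abs_of_pos (he0 n)]
    exact (div_le_one (by positivity)).2 (by have : (0:ℝ) ≤ n := by positivity
                                             linarith)
  have hel : Tendsto e atTop (𝓝[≠] 0) :=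
    tendsto_nhdsWithin_iff.2 ⟨tendsto_one_div_add_atTop_nhds_zero_nat,
      Eventually.of_forall fun n => (he0 n).ne'⟩
  let F : ℕ → ℝ → E := fun n t => (e n)⁻¹ • (b (Y t (y + e n • v)) - b (Y t y))
  let h : ℝ → E := fun t => fderiv ℝ b (Y t y) (fderiv ℝ (Y t) y v)
  have hFc : ∀ n, Continuous (F n) := fun n =>
    ((hb.continuous.comp (hcont _)).sub (hb.continuous.comp (hcont _))).const_smul _
  have hFl : ∀ t, Tendsto (fun n => F n t) atTop (𝓝 (h t)) := by
    intro t
    have h1 : HasFDerivAt (fun z => b (Y t z)) ((fderiv ℝ b (Y t y)).comp (fderiv ℝ (Y t) y)) y :=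
      ((hb.differentiable (by norm_num)) (Y t y)).hasFDerivAt.comp y
        (((hYs t).differentiable (by norm_num)) y).hasFDerivAt
    exact (h1.hasLineDerivAt v).tendsto_slope_zero.comp hel
  have hDl : ∀ t, Tendsto (fun n => (e n)⁻¹ • (Y t (y + e n • v) - Y t y)) atTop
      (𝓝 (fderiv ℝ (Y t) y v)) := fun t =>
    ((((hYs t).differentiable (by norm_num)) y).hasFDerivAt.hasLineDerivAt v).tendsto_slope_zero.comp
      hel
  have hFb : ∀ T, ∃ G, ∀ t, |t| ≤ T → ∀ n, ‖F n t‖ ≤ G := by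
    intro T
    obtain ⟨G, hG⟩ := aux_both b hb C hC hgrow Y hY0 hYd T y v
    refine ⟨G, fun t ht n => ?_⟩
    have := hG t ht (e n) (he1 n)
    simp only [F, norm_smul, norm_inv, Real.norm_eq_abs]
    rw [inv_mul_le_iff₀ (by have := (he0 n).ne'; positivity)]
    linarith
  have hm : StronglyMeasurable h :=
    stronglyMeasurable_of_tendsto atTop (fun n => (hFc n).stronglyMeasurable)
      (tendsto_pi_nhds.2 hFl)
  have hle : ∀ a c t : ℝ, t ∈ uIoc a c → |t| ≤ |a| + |c| := by
    intro a c t ht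
    have h1 := (mem_uIoc.1 ht)
    rw [abs_le]
    have := neg_abs_le a
    have := neg_abs_le c
    have := le_abs_self a
    have := le_abs_self c
    have := abs_nonneg a
    have := abs_nonneg c
    rcases h1 with h1 | h1 <;> constructor <;> linarith [h1.1, h1.2]
  have hi : ∀ a c, IntervalIntegrable h volume a c := by
    intro a c
    obtain ⟨G, hG⟩ := hFb (|a| + |c|)
    refine (intervalIntegrable_const (c := G)).mono_fun hm.aestronglyMeasurable ?_
    refine (ae_restrict_iff' measurableSet_uIoc).2 (Eventually.of_forall fun t ht => ?_)
    refine le_trans ?_ (le_abs_self G)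
    exact le_of_tendsto (hFl t).norm (Eventually.of_forall fun n => hG t (hle a c t ht) n)
  have hJ : ∀ t, fderiv ℝ (Y t) y v = v + ∫ r in (0:ℝ)..t, h r := by
    intro t
    obtain ⟨G, hG⟩ := hFb (|0| + |t|)
    have h1 : Tendsto (fun n => ∫ r in (0:ℝ)..t, F n r) atTop (𝓝 (∫ r in (0:ℝ)..t, h r)) := by
      apply intervalIntegral.tendsto_integral_filter_of_dominated_convergence (fun _ => G)
      · exact Eventually.of_forall fun n => (hFc n).aestronglyMeasurable
      · exact Eventually.of_forall fun n => Eventually.of_forall fun x hx => hG x (hle 0 t x hx) n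
      · exact intervalIntegrable_const
      · exact Eventually.of_forall fun x _ => hFl x
    have h2 : ∀ n, (e n)⁻¹ • (Y t (y + e n • v) - Y t y) = v + ∫ r in (0:ℝ)..t, F n r := by
      intro n
      rw [intervalIntegral.integral_eq_sub_of_hasDerivAt
        (f := fun r => (e n)⁻¹ • (Y r (y + e n • v) - Y r y))
        (fun x _ => ((hYd x _).sub (hYd x _)).const_smul _) ((hFc n).intervalIntegrable _ _)]
      simp [hY0, smul_smul, (he0 n).ne']
    refine tendsto_nhds_unique (hDl t) ?_
    simp_rw [h2]
    exact h1.const_add v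
  have hJc : Continuous fun t => fderiv ℝ (Y t) y v := by
    simp_rw [hJ]
    exact continuous_const.add (intervalIntegral.continuous_primitive hi 0)
  have hc : Continuous h :=
    ((hb.continuous_fderiv (by norm_num)).comp (hcont y)).clm_apply hJc
  have hfin : HasDerivAt (fun t => v + ∫ r in (0:ℝ)..t, h r) (h s) s :=
    (intervalIntegral.integral_hasDerivAt_right (hi 0 s)
      (hm.stronglyMeasurableAtFilter) hc.continuousAt).const_add v
  simpa only [← hJ] using hfin

lemma aux_lin {E : Type*} [NormedAddCommGroup E] [NormedSpace ℝ E]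
    (f : ℝ → E) (L : ℝ → E → E) (k : ℝ → ℝ) (hk : Continuous k)
    (hL : ∀ t x, ‖L t x‖ ≤ k t * ‖x‖)
    (hf : ∀ t, HasDerivAt f (L t (f t)) t) (h0 : f 0 = 0) (s : ℝ) : f s = 0 := by
  have hcont : Continuous f :=
    continuous_iff_continuousAt.2 fun s => (hf s).continuousAt
  obtain ⟨K, hK⟩ := (isCompact_Icc (a := -|s|) (b := |s|)).exists_bound_of_continuousOn hk.continuousOn
  have hb : ∀ t ∈ Icc (-|s|) |s|, ‖L t (f t)‖ ≤ K * ‖f t‖ := fun t ht =>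
    (hL t _).trans (by gcongr; exact (le_abs_self _).trans (hK t ht))
  rcases le_total 0 s with h | h
  · refine eq_zero_of_abs_deriv_le_mul_abs_self_of_eq_zero_right (K := K) (a := 0) (b := s)
      hcont.continuousOn (fun x _ => (hf x).hasDerivWithinAt) h0 (fun x hx => hb x ?_) s ⟨h, le_rfl⟩
    rw [abs_of_nonneg h]
    exact ⟨by linarith [hx.1], hx.2.le⟩
  · have := eq_zero_of_abs_deriv_le_mul_abs_self_of_eq_zero_right (K := K) (a := 0) (b := -s)
      (f := fun t => f (-t)) (f' := fun t => - L (-t) (f (-t)))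
      (hcont.comp continuous_neg).continuousOn
      (fun x _ => by
        have := (hf (-x)).scomp x (hasDerivAt_neg x)
        exact HasDerivAt.hasDerivWithinAt (by simpa [Function.comp_def] using this))
      (by simpa using h0) (fun x hx => by
        rw [norm_neg]
        refine hb (-x) ?_
        rw [abs_of_nonpos h]
        exact ⟨by linarith [hx.2], by linarith [hx.1]⟩) (-s) ⟨by linarith, le_rfl⟩
    simpa using this

lemma aux_mm {m : ℕ} (M N : ℝ → Matrix (Fin m) (Fin m) ℝ) (M' N' : Matrix (Fin m) (Fin m) ℝ)
    (s : ℝ) (hM : ∀ i j, HasDerivAt (fun t => M t i j) (M' i j) s)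
    (hN : ∀ i j, HasDerivAt (fun t => N t i j) (N' i j) s) (i j : Fin m) :
    HasDerivAt (fun t => (M t * N t) i j) ((M' * N s + M s * N') i j) s := by
  simp only [Matrix.add_apply, Matrix.mul_apply, ← Finset.sum_add_distrib]
  exact HasDerivAt.fun_sum fun k _ => (hM i k).mul (hN k j)

lemma aux_nb {m : ℕ} (D X : Matrix (Fin m) (Fin m) ℝ) (x : Fin m → Fin m → ℝ)
    (hx : ∀ i j, x i j = X i j) (i j : Fin m) :
    |(D * X + X * Dᵀ) i j| ≤ (2 * ∑ a, ∑ c, |D a c|) * ‖x‖ := by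
  have hX : ∀ i j, |X i j| ≤ ‖x‖ := fun i j => by
    rw [← hx]
    exact (norm_le_pi_norm (x i) j).trans (norm_le_pi_norm x i)
  have hrow : ∀ i, ∑ k, |D i k| * ‖x‖ ≤ (∑ a, ∑ c, |D a c|) * ‖x‖ := fun i => by
    rw [← Finset.sum_mul]
    exact mul_le_mul_of_nonneg_right (Finset.single_le_sum (f := fun a => ∑ c, |D a c|)
      (fun a _ => Finset.sum_nonneg fun c _ => abs_nonneg _) (Finset.mem_univ i)) (norm_nonneg _)
  have h1 : |(D * X) i j| ≤ (∑ a, ∑ c, |D a c|) * ‖x‖ := by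
    rw [Matrix.mul_apply]
    refine (Finset.abs_sum_le_sum_abs _ _).trans (le_trans ?_ (hrow i))
    refine Finset.sum_le_sum fun k _ => ?_
    rw [abs_mul]
    exact mul_le_mul_of_nonneg_left (hX _ _) (abs_nonneg _)
  have h2 : |(X * Dᵀ) i j| ≤ (∑ a, ∑ c, |D a c|) * ‖x‖ := by
    rw [Matrix.mul_apply]
    refine (Finset.abs_sum_le_sum_abs _ _).trans (le_trans ?_ (hrow j))
    refine Finset.sum_le_sum fun k _ => ?_
    rw [abs_mul, mul_comm, Matrix.transpose_apply]
    exact mul_le_mul_of_nonneg_left (hX _ _) (abs_nonneg _)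
  rw [Matrix.add_apply]
  refine (abs_add_le _ _).trans ?_
  linarith


/-- Let `b` be a `C¹` vector field on `ℝ^m` with linear growth and global
flow `Y`.  For a `C¹` matrix field `A`, the bracket
`[b,A] = (b·∇_y)A − (∂_y b) A − A ᵗ(∂_y b)` vanishes identically iff
`A(Y(s;y)) = ∂_y Y(s;y) A(y) ᵗ∂_y Y(s;y)` for all `s, y`. -/
theorem matrix_field_involution_iff_transported_by_flow
    (m : ℕ) (hm : 1 ≤ m)
    (b : (Fin m → ℝ) → (Fin m → ℝ)) (hb : ContDiff ℝ 1 b)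
    (C : ℝ) (hC : 0 < C) (hgrow : ∀ y, ‖b y‖ ≤ C * (1 + ‖y‖))
    (Y : ℝ → (Fin m → ℝ) → (Fin m → ℝ))
    (hY0 : ∀ y, Y 0 y = y)
    (hYd : ∀ (s : ℝ) (y : Fin m → ℝ), HasDerivAt (fun t => Y t y) (b (Y s y)) s)
    (hYs : ∀ s : ℝ, ContDiff ℝ 1 (Y s))
    (A : (Fin m → ℝ) → Matrix (Fin m) (Fin m) ℝ)
    (hA : ∀ i j, ContDiff ℝ 1 (fun y => A y i j)) :
    (∀ y, (Matrix.of fun i j => fderiv ℝ (fun z => A z i j) y (b y))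
        - (Matrix.of fun i j => fderiv ℝ (fun z => b z i) y (Pi.single j (1:ℝ))) * A y
        - A y * ((Matrix.of fun i j => fderiv ℝ (fun z => b z i) y (Pi.single j (1:ℝ)))ᵀ)
        = 0) ↔
    (∀ (s : ℝ) (y : Fin m → ℝ),
      A (Y s y)
        = (Matrix.of fun i j => fderiv ℝ (fun z => Y s z i) y (Pi.single j (1:ℝ))) * A y *
          ((Matrix.of fun i j => fderiv ℝ (fun z => Y s z i) y (Pi.single j (1:ℝ)))ᵀ)) := by
  have hcont : ∀ z, Continuous (fun t => Y t z) := fun z =>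
    continuous_iff_continuousAt.2 fun s => (hYd s z).continuousAt
  have hbd := hb.differentiable (by norm_num)
  have comp : ∀ (f : (Fin m → ℝ) → (Fin m → ℝ)), Differentiable ℝ f → ∀ i y w,
      fderiv ℝ (fun z => f z i) y w = fderiv ℝ f y w i := by
    intro f hf i y w
    have := (hasFDerivAt_pi'.1 (hf y).hasFDerivAt i).fderiv
    rw [this]
    rfl
  set D : (Fin m → ℝ) → Matrix (Fin m) (Fin m) ℝ := fun y =>
    Matrix.of fun i j => fderiv ℝ (fun z => b z i) y (Pi.single j (1:ℝ)) with hD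
  set P : ℝ → (Fin m → ℝ) → Matrix (Fin m) (Fin m) ℝ := fun s y =>
    Matrix.of fun i j => fderiv ℝ (fun z => Y s z i) y (Pi.single j (1:ℝ)) with hPdef
  set V : (Fin m → ℝ) → Matrix (Fin m) (Fin m) ℝ := fun y =>
    Matrix.of fun i j => fderiv ℝ (fun z => A z i j) y (b y) with hV
  have hDij : ∀ y i j, D y i j = fderiv ℝ b y (Pi.single j 1) i := fun y i j => by
    simp only [hD, Matrix.of_apply]
    exact comp b hbd i y _
  have hPij : ∀ s y i j, P s y i j = fderiv ℝ (Y s) y (Pi.single j 1) i := fun s y i j => by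
    simp only [hPdef, Matrix.of_apply]
    exact comp (Y s) ((hYs s).differentiable (by norm_num)) i y _
  have hP : ∀ s y i j, HasDerivAt (fun t => P t y i j) ((D (Y s y) * P s y) i j) s := by
    intro s y i j
    have h1 := hasDerivAt_pi.1 (aux_var b hb C hC hgrow Y hY0 hYd hYs y (Pi.single j 1) s) i
    simp only [hPij]
    suffices hs : (D (Y s y) * P s y) i j =
        fderiv ℝ b (Y s y) (fderiv ℝ (Y s) y (Pi.single j 1)) i by
      rw [hs]
      exact h1
    have h2 := LinearMap.pi_apply_eq_sum_univ
      (fderiv ℝ b (Y s y) : (Fin m → ℝ) →ₗ[ℝ] (Fin m → ℝ)) (fderiv ℝ (Y s) y (Pi.single j 1))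
    have h3 := congrFun h2 i
    simp only [ContinuousLinearMap.coe_coe, Finset.sum_apply, Pi.smul_apply, smul_eq_mul] at h3
    rw [h3, Matrix.mul_apply]
    refine Finset.sum_congr rfl fun k _ => ?_
    have h4 : (fun j => if k = j then (1:ℝ) else 0) = (Pi.single k 1 : Fin m → ℝ) := by
      ext l
      simp [Pi.single_apply, eq_comm]
    rw [hDij, hPij, mul_comm, h4]
  have hN : ∀ s y i j, HasDerivAt (fun t => (P t y * A y * (P t y)ᵀ) i j)
      ((D (Y s y) * (P s y * A y * (P s y)ᵀ) + (P s y * A y * (P s y)ᵀ) * (D (Y s y))ᵀ) i j) s := by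
    intro s y i j
    have h1 := aux_mm (fun t => P t y) (fun _ => A y) (D (Y s y) * P s y) 0 s (hP s y)
      (fun i j => by simpa using hasDerivAt_const s (A y i j))
    have h2 := aux_mm (fun t => P t y * A y) (fun t => (P t y)ᵀ) _ ((D (Y s y) * P s y)ᵀ) s h1
      (fun i j => hP s y j i) i j
    have h3 : D (Y s y) * (P s y * A y * (P s y)ᵀ) + (P s y * A y * (P s y)ᵀ) * (D (Y s y))ᵀ =
        (D (Y s y) * P s y * A y + P s y * 0) * (P s y)ᵀ + P s y * A y * (D (Y s y) * P s y)ᵀ := by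
      simp only [Matrix.transpose_mul, Matrix.mul_zero, add_zero, Matrix.mul_assoc]
    rw [h3]
    exact h2
  have hAd : ∀ s y i j, HasDerivAt (fun t => A (Y t y) i j) (V (Y s y) i j) s := by
    intro s y i j
    exact (((hA i j).differentiable (by norm_num)) (Y s y)).hasFDerivAt.comp_hasDerivAt s (hYd s y)
  have hP0 : ∀ y, P 0 y = 1 := by
    intro y
    ext i j
    have : Y 0 = id := funext hY0
    rw [hPij, this, fderiv_id]
    simp [Pi.single_apply, Matrix.one_apply]
  change (∀ y, V y - D y * A y - A y * (D y)ᵀ = 0) ↔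
    ∀ s y, A (Y s y) = P s y * A y * (P s y)ᵀ
  constructor
  · intro H s y
    have hVe : ∀ z, V z = D z * A z + A z * (D z)ᵀ := fun z => by
      have := H z
      rwa [sub_sub, sub_eq_zero] at this
    let f : ℝ → Fin m → Fin m → ℝ := fun t i j => (A (Y t y) - P t y * A y * (P t y)ᵀ) i j
    let L : ℝ → (Fin m → Fin m → ℝ) → (Fin m → Fin m → ℝ) := fun t x i j =>
      (D (Y t y) * Matrix.of x + Matrix.of x * (D (Y t y))ᵀ) i j
    have hf0 := aux_lin f L (fun t => 2 * ∑ a, ∑ c, |D (Y t y) a c|)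
      (by
        refine continuous_const.mul (continuous_finsetSum _ fun a _ =>
          continuous_finsetSum _ fun c _ => Continuous.abs ?_)
        simp only [hDij]
        exact (continuous_apply a).comp ((((hb.continuous_fderiv (by norm_num)).comp
          (hcont y)).clm_apply continuous_const)))
      (by
        intro t x
        have hk : 0 ≤ (2 * ∑ a, ∑ c, |D (Y t y) a c|) * ‖x‖ := by positivity
        refine (pi_norm_le_iff_of_nonneg hk).2 fun i => (pi_norm_le_iff_of_nonneg hk).2 fun j => ?_
        exact aux_nb (D (Y t y)) (Matrix.of x) x (fun _ _ => rfl) i j)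
      (by
        intro t
        refine hasDerivAt_pi.2 fun i => hasDerivAt_pi.2 fun j => ?_
        have h1 := (hAd t y i j).sub (hN t y i j)
        have h2 : L t (f t) i j = V (Y t y) i j -
          (D (Y t y) * (P t y * A y * (P t y)ᵀ) + (P t y * A y * (P t y)ᵀ) * (D (Y t y))ᵀ) i j := by
          change (D (Y t y) * (A (Y t y) - P t y * A y * (P t y)ᵀ)
            + (A (Y t y) - P t y * A y * (P t y)ᵀ) * (D (Y t y))ᵀ) i j = _
          rw [hVe, ← Matrix.sub_apply]
          refine congrFun (congrFun (?_ : (_ : Matrix (Fin m) (Fin m) ℝ) = _) i) j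
          rw [Matrix.mul_sub, Matrix.sub_mul]
          abel
        rw [h2]
        exact h1)
      (by
        funext i j
        simp [f, hY0, hP0]) s
    rw [← sub_eq_zero]
    ext i j
    exact congrFun (congrFun hf0 i) j
  · intro H y
    rw [sub_sub, sub_eq_zero]
    ext i j
    have h1 := hAd 0 y i j
    have h2 := hN 0 y i j
    simp only [← H, hY0] at h1 h2
    exact h1.unique h2
end
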